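/- Let t ≥ 2 and a, c ≥ 1 be integers. The graph K_c ⊕ (tK_a), the join of K_c with the disjoint union of t copies of K_a, has exactly two main Q-eigenvalues. -/

import Mathlib

open SimpleGraph

/-- The signless Laplacian matrix `Q(G) = D(G) + A(G)` of a finite simple graph. -/
noncomputable def signlessLaplacian {V : Type*} [Fintype V] (G : SimpleGraph V) :
    Matrix V V ℝ :=
  letI := Classical.decEq V
  letI := Classical.decRel G.Adj
  Matrix.diagonal (fun v => (G.degree v : ℝ)) + G.adjMatrix ℝ

/-- `q` is a main Q-eigenvalue of `G`: some eigenvector of `Q(G)` for `q`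
has nonzero entry sum. -/
def IsMainQEigenvalue {V : Type*} [Fintype V] (G : SimpleGraph V) (q : ℝ) : Prop :=
  ∃ x : V → ℝ, (signlessLaplacian G).mulVec x = q • x ∧ (∑ v, x v) ≠ 0

/-- The number of (distinct) main Q-eigenvalues of `G`. -/
noncomputable def mainQCount {V : Type*} [Fintype V] (G : SimpleGraph V) : ℕ :=
  {q : ℝ | IsMainQEigenvalue G q}.ncard

/-- `G` contains an induced copy of `H`. -/
def HasInducedCopy {α β : Type*} (H : SimpleGraph α) (G : SimpleGraph β) : Prop :=
  ∃ f : α ↪ β, ∀ a b : α, H.Adj a b ↔ G.Adj (f a) (f b)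

/-- A cograph is a `P₄`-free graph. -/
def IsCograph {V : Type*} (G : SimpleGraph V) : Prop :=
  ¬ HasInducedCopy (SimpleGraph.pathGraph 4) G

/-- A quasi-threshold graph is a `{P₄, C₄}`-free graph. -/
def IsQuasiThreshold {V : Type*} (G : SimpleGraph V) : Prop :=
  ¬ HasInducedCopy (SimpleGraph.pathGraph 4) G ∧
  ¬ HasInducedCopy (SimpleGraph.cycleGraph 4) G

/-- A chordal graph: no induced cycle of length at least 4. -/
def IsChordal {V : Type*} (G : SimpleGraph V) : Prop :=
  ∀ n : ℕ, 4 ≤ n → ¬ HasInducedCopy (SimpleGraph.cycleGraph n) G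

/-- The join `G ⊕ H` of two vertex-disjoint graphs. -/
def graphJoin {V W : Type*} (G : SimpleGraph V) (H : SimpleGraph W) :
    SimpleGraph (V ⊕ W) where
  Adj x y :=
    match x, y with
    | Sum.inl a, Sum.inl b => G.Adj a b
    | Sum.inr a, Sum.inr b => H.Adj a b
    | Sum.inl _, Sum.inr _ => True
    | Sum.inr _, Sum.inl _ => True
  symm := by
    refine ⟨?_⟩
    rintro (a | a) (b | b) h
    · exact G.symm.symm _ _ h
    · trivial
    · trivial
    · exact H.symm.symm _ _ h
  loopless := by
    refine ⟨?_⟩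
    rintro (a | a) h
    · exact G.loopless.irrefl a h
    · exact H.loopless.irrefl a h

/-- The disjoint union `G ∪ H` of two vertex-disjoint graphs. -/
def disjUnionGraph {V W : Type*} (G : SimpleGraph V) (H : SimpleGraph W) :
    SimpleGraph (V ⊕ W) where
  Adj x y :=
    match x, y with
    | Sum.inl a, Sum.inl b => G.Adj a b
    | Sum.inr a, Sum.inr b => H.Adj a b
    | _, _ => False
  symm := by
    refine ⟨?_⟩
    rintro (a | a) (b | b) h
    · exact G.symm.symm _ _ h
    · exact h.elim
    · exact h.elim
    · exact H.symm.symm _ _ h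
  loopless := by
    refine ⟨?_⟩
    rintro (a | a) h
    · exact G.loopless.irrefl a h
    · exact H.loopless.irrefl a h

/-- `tK_a`: the disjoint union of `t` copies of the complete graph `K_a`. -/
def copiesComplete (t a : ℕ) : SimpleGraph (Fin t × Fin a) where
  Adj x y := x.1 = y.1 ∧ x.2 ≠ y.2
  symm := ⟨fun _ _ ⟨h1, h2⟩ => ⟨h1.symm, h2.symm⟩⟩
  loopless := ⟨fun _ ⟨_, h⟩ => h rfl⟩

/-- The disjoint union `a₁ K_{n₁} ∪ ⋯ ∪ a_p K_{n_p}`: for each `i : Fin p`,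
`a i` copies of the complete graph on `n i` vertices. Two vertices are adjacent
iff they lie in the same copy of the same complete graph and are distinct. -/
def satellites (p : ℕ) (a n : Fin p → ℕ) :
    SimpleGraph ((i : Fin p) × (Fin (a i) × Fin (n i))) where
  Adj x y := x.1 = y.1 ∧ HEq x.2.1 y.2.1 ∧ ¬ HEq x.2.2 y.2.2
  symm := ⟨fun _ _ ⟨h1, h2, h3⟩ => ⟨h1.symm, h2.symm, fun h => h3 h.symm⟩⟩
  loopless := ⟨fun _ ⟨_, _, h3⟩ => h3 HEq.rfl⟩


theorem sl_mulVec {V : Type*} [Fintype V] (G : SimpleGraph V) (x : V → ℝ) (v : V) :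
    (signlessLaplacian G).mulVec x v
      = ∑ w, (open Classical in if G.Adj v w then x v + x w else 0) := by
  classical
  unfold signlessLaplacian
  simp only [Matrix.add_mulVec, Pi.add_apply, Matrix.mulVec_diagonal]
  have h1 : ∀ w, (if G.Adj v w then x v + x w else 0)
      = (if G.Adj v w then x v else 0) + (if G.Adj v w then x w else 0) := by
    intro w; split_ifs <;> simp
  simp only [h1, Finset.sum_add_distrib]
  congr 1
  · rw [← Finset.sum_filter, Finset.sum_const, nsmul_eq_mul, ← SimpleGraph.card_neighborFinset_eq_degree]
    congr 3
    ext w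
    simp
  · simp only [Matrix.mulVec, dotProduct, SimpleGraph.adjMatrix_apply, ite_mul, one_mul, zero_mul]

theorem sum_ne_aux (n : ℕ) (f : Fin n → ℝ) (i : Fin n) :
    ∑ j, (open Classical in if i ≠ j then f i + f j else 0) = ((n : ℝ) - 2) * f i + ∑ j, f j := by
  classical
  have h : ∀ j, (if i ≠ j then f i + f j else 0)
      = f i + f j - (if i = j then 2 * f j else 0) := by
    intro j
    by_cases h : i = j
    · subst h; simp; ring
    · simp [h]
  simp only [h, Finset.sum_sub_distrib, Finset.sum_add_distrib]
  simp
  ring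

theorem sl_inl (t a c : ℕ) (x : Fin c ⊕ (Fin t × Fin a) → ℝ) (i : Fin c) :
    (signlessLaplacian (graphJoin (⊤ : SimpleGraph (Fin c)) (copiesComplete t a))).mulVec x (Sum.inl i)
      = ((c : ℝ) - 2 + t * a) * x (Sum.inl i) + ∑ j, x (Sum.inl j) + ∑ p, x (Sum.inr p) := by
  classical
  rw [sl_mulVec, Fintype.sum_sum_type]
  have h := sum_ne_aux c (fun j => x (Sum.inl j)) i
  simp only [graphJoin, SimpleGraph.top_adj, if_true, Finset.sum_add_distrib]
  rw [h]
  simp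
  ring

theorem sl_inr (t a c : ℕ) (x : Fin c ⊕ (Fin t × Fin a) → ℝ) (j : Fin t) (k : Fin a) :
    (signlessLaplacian (graphJoin (⊤ : SimpleGraph (Fin c)) (copiesComplete t a))).mulVec x (Sum.inr (j, k))
      = ((a : ℝ) - 2 + c) * x (Sum.inr (j, k)) + ∑ l, x (Sum.inr (j, l)) + ∑ i, x (Sum.inl i) := by
  classical
  rw [sl_mulVec, Fintype.sum_sum_type]
  have h := sum_ne_aux a (fun l => x (Sum.inr (j, l))) k
  have h2 : ∑ p : Fin t × Fin a, (if j = p.1 ∧ k ≠ p.2 then x (Sum.inr (j, k)) + x (Sum.inr p) else 0)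
      = ((a : ℝ) - 2) * x (Sum.inr (j, k)) + ∑ l, x (Sum.inr (j, l)) := by
    rw [← h, Fintype.sum_prod_type, Finset.sum_eq_single j]
    · simp
    · intro b _ hb
      simp [hb.symm]
    · simp
  have hA : ∀ p, (graphJoin (⊤ : SimpleGraph (Fin c)) (copiesComplete t a)).Adj (Sum.inr (j, k)) (Sum.inr p)
      ↔ (j = p.1 ∧ k ≠ p.2) := fun p => Iff.rfl
  have hB : ∀ i, (graphJoin (⊤ : SimpleGraph (Fin c)) (copiesComplete t a)).Adj (Sum.inr (j, k)) (Sum.inl i)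
      ↔ True := fun i => Iff.rfl
  simp only [hA, hB, if_true, Finset.sum_add_distrib]
  rw [h2]
  simp
  ring

theorem main_iff (t a c : ℕ) (ht : 2 ≤ t) (ha : 1 ≤ a) (hc : 1 ≤ c) (q : ℝ) :
    IsMainQEigenvalue (graphJoin (⊤ : SimpleGraph (Fin c)) (copiesComplete t a)) q ↔
      (q - (2 * c - 2 + t * a)) * (q - (2 * a + c - 2)) - c * (t * a) = 0 := by
  have ht' : (2 : ℝ) ≤ t := by exact_mod_cast ht
  have ha' : (1 : ℝ) ≤ a := by exact_mod_cast ha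
  have hc' : (1 : ℝ) ≤ c := by exact_mod_cast hc
  constructor
  · rintro ⟨x, hx, hs⟩
    rw [Fintype.sum_sum_type] at hs
    have e1 : q * ∑ i, x (Sum.inl i)
        = (2 * c - 2 + t * a) * (∑ i, x (Sum.inl i)) + c * ∑ p, x (Sum.inr p) := by
      have : ∀ i, q * x (Sum.inl i) = ((c : ℝ) - 2 + t * a) * x (Sum.inl i) + ∑ j, x (Sum.inl j) + ∑ p, x (Sum.inr p) := by
        intro i
        rw [← sl_inl, hx]; rfl
      rw [Finset.mul_sum, Finset.sum_congr rfl (fun i _ => this i)]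
      simp only [Finset.sum_add_distrib, ← Finset.mul_sum, Finset.sum_const, Finset.card_univ, Fintype.card_fin, nsmul_eq_mul]
      ring
    have e2 : q * ∑ p, x (Sum.inr p)
        = (2 * a + c - 2) * (∑ p, x (Sum.inr p)) + t * a * ∑ i, x (Sum.inl i) := by
      have : ∀ j k, q * x (Sum.inr (j, k)) = ((a : ℝ) - 2 + c) * x (Sum.inr (j, k)) + ∑ l, x (Sum.inr (j, l)) + ∑ i, x (Sum.inl i) := by
        intro j k
        rw [← sl_inr, hx]; rfl
      rw [Fintype.sum_prod_type, Finset.mul_sum]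
      simp only [Finset.mul_sum _ _ q, this]
      simp only [Finset.sum_add_distrib, ← Finset.mul_sum, Finset.sum_const, Finset.card_univ, Fintype.card_fin, nsmul_eq_mul]
      ring
    generalize (∑ i, x (Sum.inl i)) = X at *
    generalize (∑ p, x (Sum.inr p)) = Y at *
    by_contra hne
    have hX : X = 0 := by
      apply (mul_eq_zero.1 _).resolve_left hne
      linear_combination (q - (2 * a + c - 2)) * e1 + c * e2
    have hY : Y = 0 := by
      apply (mul_eq_zero.1 _).resolve_left hne
      linear_combination (q - (2 * c - 2 + t * a)) * e2 + t * a * e1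
    simp [hX, hY] at hs
  · intro h
    refine ⟨Sum.elim (fun _ => q - (2 * a + c - 2)) (fun _ => (c : ℝ)), ?_, ?_⟩
    · ext v
      rcases v with i | ⟨j, k⟩
      · rw [sl_inl]
        simp
        linear_combination -h
      · rw [sl_inr]
        simp
        ring
    · simp
      intro h0
      have h1 : (c : ℝ) * (q - (2 * a + c - 2) + t * a) = 0 := by linear_combination h0
      have h2 := (mul_eq_zero.1 h1).resolve_left (by positivity)
      have h3 : q = 2 * a + c - 2 - t * a := by linear_combination h2
      subst h3
      have h4 : (t : ℝ) * a * a * (t - 1) = 0 := by linear_combination h / 2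
      have : (t : ℝ) * a * a * (t - 1) > 0 := by
        have : (t : ℝ) - 1 > 0 := by linarith
        positivity
      linarith

theorem join_complete_copies_complete_two_main
    (t a c : ℕ) (ht : 2 ≤ t) (ha : 1 ≤ a) (hc : 1 ≤ c) :
    mainQCount (graphJoin (⊤ : SimpleGraph (Fin c)) (copiesComplete t a)) = 2 := by
  unfold mainQCount
  simp only [main_iff t a c ht ha hc]
  have ht' : (2 : ℝ) ≤ t := by exact_mod_cast ht
  have ha' : (1 : ℝ) ≤ a := by exact_mod_cast ha
  have hc' : (1 : ℝ) ≤ c := by exact_mod_cast hc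
  have hm : (0 : ℝ) < c * (t * a) := by positivity
  generalize (c : ℝ) * (t * a) = m at *
  generalize (2 * c - 2 + t * a : ℝ) = p at *
  generalize (2 * a + c - 2 : ℝ) = r at *
  have hD : 0 < (p - r) ^ 2 + 4 * m := by positivity
  obtain ⟨s, hs, hs2⟩ : ∃ s : ℝ, 0 < s ∧ s ^ 2 = (p - r) ^ 2 + 4 * m :=
    ⟨_, Real.sqrt_pos.2 hD, Real.sq_sqrt hD.le⟩
  rw [Set.ncard_eq_two]
  refine ⟨(p + r + s) / 2, (p + r - s) / 2, by intro h; linarith, ?_⟩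
  ext q
  simp only [Set.mem_ofPred_eq, Set.mem_insert_iff, Set.mem_singleton_iff]
  have key : (q - p) * (q - r) - m = (q - (p + r + s) / 2) * (q - (p + r - s) / 2) := by
    linear_combination hs2 / 4
  rw [key, mul_eq_zero, sub_eq_zero, sub_eq_zero]
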